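/- For every integer n ≥ 2 one has the lowering ladder identity of polynomials q_{2,n}(x) S_n(x) + q_{0,n}(x) S_n′(x) = q_{1,n}(x) S_{n−1}(x); moreover, for n ≥ d+1, deg q_{0,n} = 2d+2, deg q_{1,n} = 2d and deg q_{2,n} = 2d+1. -/

import Mathlib

open Polynomial MeasureTheory Finset

noncomputable section

/-- The `k`-th derivative of a real polynomial. -/
def iterDeriv (k : ℕ) (f : Polynomial ℝ) : Polynomial ℝ := Polynomial.derivative^[k] f

/-- The Jacobi measure `dμ^{α,β}(x) = (1-x)^α (1+x)^β dx` on `[-1,1]`. -/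
def jacobiMeasure (α β : ℝ) : Measure ℝ :=
  (volume.restrict (Set.Icc (-1 : ℝ) 1)).withDensity
    fun x => ENNReal.ofReal ((1 - x) ^ α * (1 + x) ^ β)

/-- The Jacobi–Sobolev inner product
`⟨f,g⟩_S = ∫ f g dμ^{α,β} + ∑_{j=1}^N ∑_{k=0}^{d_j} λ_{j,k} f^{(k)}(c_j) g^{(k)}(c_j)`. -/
def sobolevIP (α β : ℝ) {N : ℕ} (c : Fin N → ℝ) (dd : Fin N → ℕ)
    (lam : Fin N → ℕ → ℝ) (f g : Polynomial ℝ) : ℝ :=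
  (∫ x, f.eval x * g.eval x ∂(jacobiMeasure α β)) +
    ∑ j : Fin N, ∑ k ∈ Finset.range (dd j + 1),
      lam j k * (iterDeriv k f).eval (c j) * (iterDeriv k g).eval (c j)

/-- The degree-`k` Taylor polynomial of `f` centred at `c`:
`Q_k(x,c;f) = ∑_{ν=0}^k f^{(ν)}(c)(x-c)^ν/ν!` (as a polynomial in `x`). -/
def taylorPoly (k : ℕ) (c : ℝ) (f : Polynomial ℝ) : Polynomial ℝ :=
  ∑ ν ∈ Finset.range (k + 1),
    Polynomial.C ((iterDeriv ν f).eval c / Nat.factorial ν) * (X - Polynomial.C c) ^ ν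

/-- `ρ(x) = ∏_{j=1}^N (x-c_j)^{d_j+1}`. -/
def rhoPoly {N : ℕ} (c : Fin N → ℝ) (dd : Fin N → ℕ) : Polynomial ℝ :=
  ∏ j : Fin N, (X - Polynomial.C (c j)) ^ (dd j + 1)

/-- `ρ_{j,k}(x) = ρ(x)/(x-c_j)^{k+1} = (x-c_j)^{d_j-k} ∏_{i≠j} (x-c_i)^{d_i+1}`. -/
def rhoJK {N : ℕ} (c : Fin N → ℝ) (dd : Fin N → ℕ) (j : Fin N) (k : ℕ) : Polynomial ℝ :=
  (X - Polynomial.C (c j)) ^ (dd j - k) *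
    ∏ i ∈ Finset.univ.erase j, (X - Polynomial.C (c i)) ^ (dd i + 1)

/-- `â_n(x) = -n((2n+α+β)x+β-α)/(2n+α+β)`. -/
def ahat (α β : ℝ) (n : ℕ) : Polynomial ℝ :=
  Polynomial.C (-(n : ℝ) / (2 * (n : ℝ) + α + β)) *
    (Polynomial.C (2 * (n : ℝ) + α + β) * X + Polynomial.C (β - α))

/-- `b̂_n = 4n(n+α)(n+β)(n+α+β)/((2n+α+β)²(2n+α+β-1))`. -/
def bhat (α β : ℝ) (n : ℕ) : ℝ :=
  4 * (n : ℝ) * ((n : ℝ) + α) * ((n : ℝ) + β) * ((n : ℝ) + α + β) /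
    ((2 * (n : ℝ) + α + β) ^ 2 * (2 * (n : ℝ) + α + β - 1))

/-- `ĉ_n(x) = (n+α+β)((2n+α+β)x+α-β)/(2n+α+β)`. -/
def chat (α β : ℝ) (n : ℕ) : Polynomial ℝ :=
  Polynomial.C (((n : ℝ) + α + β) / (2 * (n : ℝ) + α + β)) *
    (Polynomial.C (2 * (n : ℝ) + α + β) * X + Polynomial.C (α - β))

/-- `d̂_n = -(2n+α+β-1)`. -/
def dhat (α β : ℝ) (n : ℕ) : ℝ := -(2 * (n : ℝ) + α + β - 1)

/-- `γ_{1,n} = (β²-α²)/((2n+α+β)(2n+α+β+2))`. -/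
def gamma1 (α β : ℝ) (n : ℕ) : ℝ :=
  (β ^ 2 - α ^ 2) / ((2 * (n : ℝ) + α + β) * (2 * (n : ℝ) + α + β + 2))

/-- `γ_{2,n} = 4n(n+α)(n+β)(n+α+β)/((2n+α+β)²((2n+α+β)²-1))`. -/
def gamma2 (α β : ℝ) (n : ℕ) : ℝ :=
  4 * (n : ℝ) * ((n : ℝ) + α) * ((n : ℝ) + β) * ((n : ℝ) + α + β) /
    ((2 * (n : ℝ) + α + β) ^ 2 * ((2 * (n : ℝ) + α + β) ^ 2 - 1))

lemma intervalIntegrable_jacobiWeight {α β : ℝ} (hα : -1 < α) (hβ : -1 < β) :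
    IntervalIntegrable (fun x : ℝ => (1 - x) ^ α * (1 + x) ^ β) volume (-1) 1 := by
  have hl : IntervalIntegrable (fun x : ℝ => (1 + x) ^ β) volume (-1) 0 := by
    simpa [add_comm] using
      (intervalIntegral.intervalIntegrable_rpow' (a := 0) (b := 1) hβ).comp_add_right 1
  have hr : IntervalIntegrable (fun x : ℝ => (1 - x) ^ α) volume 0 1 := by
    simpa using
      (intervalIntegral.intervalIntegrable_rpow' (a := 1) (b := 0) hα).comp_sub_left 1
  refine IntervalIntegrable.trans (b := 0) ?_ ?_
  · refine hl.continuousOn_mul (ContinuousOn.rpow_const (by fun_prop) fun x hx => Or.inl ?_)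
    rw [Set.uIcc_of_le (by norm_num)] at hx
    linarith [hx.2]
  · refine hr.mul_continuousOn (ContinuousOn.rpow_const (by fun_prop) fun x hx => Or.inl ?_)
    rw [Set.uIcc_of_le (by norm_num)] at hx
    linarith [hx.1]

lemma measurable_jacobiDensity (α β : ℝ) :
    Measurable fun x : ℝ => ENNReal.ofReal ((1 - x) ^ α * (1 + x) ^ β) := by
  fun_prop

lemma toReal_jacobiDensity_ae (α β : ℝ) (p : Polynomial ℝ) :
    (fun x : ℝ => (ENNReal.ofReal ((1 - x) ^ α * (1 + x) ^ β)).toReal • p.eval x)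
      =ᵐ[volume.restrict (Set.Icc (-1 : ℝ) 1)]
        fun x => (1 - x) ^ α * (1 + x) ^ β * p.eval x := by
  filter_upwards [ae_restrict_mem measurableSet_Icc] with x hx
  rw [ENNReal.toReal_ofReal (mul_nonneg (Real.rpow_nonneg (by linarith [hx.2]) _)
    (Real.rpow_nonneg (by linarith [hx.1]) _)), smul_eq_mul]

lemma integrable_eval_jacobiMeasure {α β : ℝ} (hα : -1 < α) (hβ : -1 < β) (p : Polynomial ℝ) :
    Integrable (fun x => p.eval x) (jacobiMeasure α β) := by
  rw [jacobiMeasure, integrable_withDensity_iff_integrable_smul' (measurable_jacobiDensity α β)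
    (by simp), integrable_congr (toReal_jacobiDensity_ae α β p)]
  have := (intervalIntegrable_jacobiWeight hα hβ).mul_continuousOn p.continuousOn
  rwa [intervalIntegrable_iff_integrableOn_Icc_of_le (by norm_num)] at this

lemma integral_eval_jacobiMeasure (α β : ℝ) (p : Polynomial ℝ) :
    ∫ x, p.eval x ∂(jacobiMeasure α β) =
      ∫ x in (-1 : ℝ)..1, (1 - x) ^ α * (1 + x) ^ β * p.eval x := by
  rw [jacobiMeasure, integral_withDensity_eq_integral_toReal_smul (measurable_jacobiDensity α β)
    (by simp), integral_congr_ae (toReal_jacobiDensity_ae α β p),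
    intervalIntegral.integral_of_le (by norm_num), integral_Icc_eq_integral_Ioc]

/-- Integration of polynomials against the Jacobi measure, as a linear functional. -/
def jacobiFunctional {α β : ℝ} (hα : -1 < α) (hβ : -1 < β) : Polynomial ℝ →ₗ[ℝ] ℝ where
  toFun p := ∫ x, p.eval x ∂(jacobiMeasure α β)
  map_add' p q := by
    simpa using integral_add (integrable_eval_jacobiMeasure hα hβ p)
      (integrable_eval_jacobiMeasure hα hβ q)
  map_smul' a p := by simp [integral_const_mul]

lemma jacobiFunctional_sq_pos {α β : ℝ} (hα : -1 < α) (hβ : -1 < β) {p : Polynomial ℝ}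
    (hp : p ≠ 0) : 0 < jacobiFunctional hα hβ (p * p) := by
  change 0 < ∫ x, (p * p).eval x ∂(jacobiMeasure α β)
  rw [integral_pos_iff_support_of_nonneg (fun x => by simpa using mul_self_nonneg (p.eval x))
    (integrable_eval_jacobiMeasure hα hβ _), pos_iff_ne_zero]
  intro h0
  rw [jacobiMeasure, withDensity_apply_eq_zero (measurable_jacobiDensity α β)] at h0
  have hsub : Set.Ioo (-1 : ℝ) 1 \ (p.roots.toFinset : Set ℝ) ⊆
      {x : ℝ | ENNReal.ofReal ((1 - x) ^ α * (1 + x) ^ β) ≠ 0} ∩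
        Function.support fun x => (p * p).eval x := by
    rintro x ⟨hx, hr⟩
    refine ⟨?_, ?_⟩
    · have : 0 < (1 - x) ^ α * (1 + x) ^ β := mul_pos (Real.rpow_pos_of_pos (by linarith [hx.2]) _)
        (Real.rpow_pos_of_pos (by linarith [hx.1]) _)
      simpa using this
    · simpa [hp] using hr
  have h1 := measure_mono_null hsub h0
  rw [measure_sdiff_null (Finset.measure_zero _ _),
    Measure.restrict_apply measurableSet_Ioo,
    Set.inter_eq_left.2 Set.Ioo_subset_Icc_self, Real.volume_Ioo] at h1
  norm_num at h1

/-- The Pearson equation of the Jacobi weight, in integrated form. -/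
lemma jacobiFunctional_pearson {α β : ℝ} (hα : -1 < α) (hβ : -1 < β) (f : Polynomial ℝ) :
    jacobiFunctional hα hβ ((1 - X ^ 2) * derivative f +
      (C (β - α) - C (α + β + 2) * X) * f) = 0 := by
  change ∫ x, Polynomial.eval x _ ∂(jacobiMeasure α β) = 0
  have hint := intervalIntegrable_jacobiWeight hα hβ
  have key := intervalIntegral.integral_eq_sub_of_hasDerivAt_of_le (a := -1) (b := 1)
    (f := fun x : ℝ => (1 - x) ^ (α + 1) * (1 + x) ^ (β + 1) * f.eval x)
    (f' := fun x : ℝ => (1 - x) ^ α * (1 + x) ^ β *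
      Polynomial.eval x ((1 - X ^ 2) * derivative f + (C (β - α) - C (α + β + 2) * X) * f))
    (by norm_num) ?_ ?_ (hint.mul_continuousOn (Polynomial.continuousOn _))
  · rw [integral_eval_jacobiMeasure, key]
    simp [Real.zero_rpow (by linarith : α + 1 ≠ 0), Real.zero_rpow (by linarith : β + 1 ≠ 0)]
  · refine ContinuousOn.mul (ContinuousOn.mul ?_ ?_) f.continuousOn
    · exact ContinuousOn.rpow_const (by fun_prop) fun x _ => Or.inr (by linarith)
    · exact ContinuousOn.rpow_const (by fun_prop) fun x _ => Or.inr (by linarith)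
  · intro x hx
    have h1 : 0 < 1 - x := by linarith [hx.2]
    have h2 : 0 < 1 + x := by linarith [hx.1]
    have d1 := ((hasDerivAt_id x).const_sub 1).rpow_const (p := α + 1) (Or.inl h1.ne')
    have d2 := ((hasDerivAt_id x).const_add 1).rpow_const (p := β + 1) (Or.inl h2.ne')
    refine ((d1.mul d2).mul (f.hasDerivAt x)).congr_deriv ?_
    simp only [id, Real.rpow_add_one h1.ne', Real.rpow_add_one h2.ne', add_sub_cancel_right,
      eval_add, eval_mul, eval_sub, eval_pow, eval_X, eval_one, eval_C, Pi.mul_apply]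
    ring

/-- `p` has degree at most `k`, and `a` is its coefficient of degree `k`. -/
def HasTopCoeff (p : Polynomial ℝ) (k : ℕ) (a : ℝ) : Prop :=
  p.natDegree ≤ k ∧ p.coeff k = a

namespace HasTopCoeff

variable {p q : Polynomial ℝ} {k l : ℕ} {a b : ℝ}

lemma add (hp : HasTopCoeff p k a) (hq : HasTopCoeff q k b) : HasTopCoeff (p + q) k (a + b) :=
  ⟨natDegree_add_le_of_degree_le hp.1 hq.1, by rw [coeff_add, hp.2, hq.2]⟩

lemma sub (hp : HasTopCoeff p k a) (hq : HasTopCoeff q k b) : HasTopCoeff (p - q) k (a - b) :=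
  ⟨natDegree_sub_le_of_le hp.1 hq.1 |>.trans (by simp), by rw [coeff_sub, hp.2, hq.2]⟩

lemma mul (hp : HasTopCoeff p k a) (hq : HasTopCoeff q l b) :
    HasTopCoeff (p * q) (k + l) (a * b) :=
  ⟨natDegree_mul_le_of_le hp.1 hq.1, by
    rw [coeff_mul_add_eq_of_natDegree_le hp.1 hq.1, hp.2, hq.2]⟩

lemma of_lt (hp : HasTopCoeff p k a) (hkl : k < l) : HasTopCoeff p l 0 :=
  ⟨hp.1.trans hkl.le, coeff_eq_zero_of_natDegree_lt (hp.1.trans_lt hkl)⟩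

lemma const (a : ℝ) : HasTopCoeff (C a) 0 a := ⟨by simp, by simp⟩

lemma C_mul (hp : HasTopCoeff p k a) (b : ℝ) : HasTopCoeff (C b * p) k (b * a) := by
  simpa using (const b).mul hp

lemma of_monic (hp : p.Monic) : HasTopCoeff p p.natDegree 1 := ⟨le_rfl, hp⟩

lemma linear (a b : ℝ) : HasTopCoeff (C a * X + C b) 1 a := ⟨by compute_degree, by simp⟩

lemma sum {ι : Type*} (s : Finset ι) {f : ι → Polynomial ℝ} {a : ι → ℝ}
    (hf : ∀ i ∈ s, HasTopCoeff (f i) k (a i)) : HasTopCoeff (∑ i ∈ s, f i) k (∑ i ∈ s, a i) :=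
  ⟨natDegree_sum_le_of_forall_le _ _ fun i hi => (hf i hi).1, by
    rw [finsetSum_coeff]; exact Finset.sum_congr rfl fun i hi => (hf i hi).2⟩

lemma natDegree_eq (hp : HasTopCoeff p k a) (ha : a ≠ 0) : p.natDegree = k :=
  natDegree_eq_of_le_of_coeff_ne_zero hp.1 (by rwa [hp.2])

lemma degree_lt (hp : HasTopCoeff p k 0) : p.degree < k := by
  rw [degree_lt_iff_coeff_zero]
  intro i hi
  rcases hi.eq_or_lt with rfl | hi
  · exact hp.2
  · exact coeff_eq_zero_of_natDegree_lt (hp.1.trans_lt hi)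

lemma one_sub_X_sq : HasTopCoeff (1 - X ^ 2 : Polynomial ℝ) 2 (-1) :=
  ⟨by compute_degree, by simp [coeff_one]⟩

lemma one_sub_X_sq_mul_derivative (hp : HasTopCoeff p k a) :
    HasTopCoeff ((1 - X ^ 2) * derivative p) (k + 1) (-k * a) := by
  rcases k with _ | k
  · rw [eq_C_of_natDegree_le_zero hp.1]
    simp [HasTopCoeff]
  · have h1 : HasTopCoeff (derivative p) k (a * (k + 1)) :=
      ⟨(natDegree_derivative_le p).trans (by have := hp.1; omega), by
        rw [coeff_derivative, hp.2]⟩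
    have h2 := one_sub_X_sq.mul h1
    rw [show 2 + k = k + 1 + 1 by ring] at h2
    convert h2 using 1
    push_cast
    ring

end HasTopCoeff

/-- `P` is a sequence of monic orthogonal polynomials for the positive definite functional `L`. -/
structure IsMonicOPS (L : Polynomial ℝ →ₗ[ℝ] ℝ) (P : ℕ → Polynomial ℝ) : Prop where
  pos : ∀ p, p ≠ 0 → 0 < L (p * p)
  monic : ∀ m, (P m).Monic
  natDegree_eq : ∀ m, (P m).natDegree = m
  orth : ∀ m l, m ≠ l → L (P m * P l) = 0

lemma bhat_eq {α β : ℝ} (hα : -1 < α) (hβ : -1 < β) {n : ℕ} (hn : 2 ≤ n) :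
    bhat α β n = (2 * (n : ℝ) + α + β + 1) * gamma2 α β n := by
  have hn' : (2 : ℝ) ≤ n := by exact_mod_cast hn
  have h1 : 2 * (n : ℝ) + α + β ≠ 0 := by linarith
  have h2 : 2 * (n : ℝ) + α + β - 1 ≠ 0 := by linarith
  have h3 : 2 * (n : ℝ) + α + β + 1 ≠ 0 := by linarith
  rw [bhat, gamma2]
  generalize 2 * (n : ℝ) + α + β = s at *
  rw [show s ^ 2 - 1 = (s - 1) * (s + 1) by ring]
  field_simp

namespace IsMonicOPS

variable {L : Polynomial ℝ →ₗ[ℝ] ℝ} {P : ℕ → Polynomial ℝ}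

lemma norm_pos (hP : IsMonicOPS L P) (m : ℕ) : 0 < L (P m * P m) :=
  hP.pos _ (hP.monic m).ne_zero

lemma hasTopCoeff (hP : IsMonicOPS L P) (m : ℕ) : HasTopCoeff (P m) m 1 := by
  simpa only [hP.natDegree_eq] using HasTopCoeff.of_monic (hP.monic m)

lemma exists_eq_sum (hP : IsMonicOPS L P) (n : ℕ) (q : Polynomial ℝ) (hq : q.degree < n) :
    ∃ a : ℕ → ℝ, q = ∑ i ∈ Finset.range n, a i • P i := by
  induction n generalizing q with
  | zero => exact ⟨0, by simpa using hq⟩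
  | succ n ih =>
    have htop : HasTopCoeff q n (q.coeff n) :=
      ⟨natDegree_le_iff_coeff_eq_zero.2 fun i hi => (degree_lt_iff_coeff_zero _ _).1 hq i hi, rfl⟩
    have h0 := htop.sub ((hP.hasTopCoeff n).C_mul (q.coeff n))
    rw [mul_one, sub_self] at h0
    obtain ⟨a, ha⟩ := ih _ h0.degree_lt
    refine ⟨Function.update a n (q.coeff n), ?_⟩
    rw [Finset.sum_range_succ, Function.update_self, smul_eq_C_mul, ← sub_eq_iff_eq_add, ha]
    refine Finset.sum_congr rfl fun i hi => ?_
    rw [Function.update_of_ne (Finset.mem_range.1 hi).ne]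

lemma map_mul_sum (hP : IsMonicOPS L P) (n : ℕ) (a : ℕ → ℝ) {i : ℕ} (hi : i < n) :
    L (P i * ∑ l ∈ Finset.range n, a l • P l) = a i * L (P i * P i) := by
  rw [Finset.mul_sum, map_sum, Finset.sum_eq_single i]
  · simp
  · intro l _ hl
    simp [hP.orth i l hl.symm]
  · simp [hi]

/-- A polynomial of degree less than `n` equals its Fourier sum. -/
lemma eq_sum (hP : IsMonicOPS L P) (n : ℕ) {q : Polynomial ℝ} (hq : q.degree < n) :
    q = ∑ i ∈ Finset.range n, (L (P i * q) / L (P i * P i)) • P i := by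
  obtain ⟨a, ha⟩ := hP.exists_eq_sum n q hq
  conv_lhs => rw [ha]
  refine Finset.sum_congr rfl fun i hi => ?_
  rw [ha, hP.map_mul_sum n a (Finset.mem_range.1 hi),
    mul_div_cancel_right₀ _ (hP.norm_pos i).ne']

lemma map_mul_of_hasTopCoeff (hP : IsMonicOPS L P) {m : ℕ} {q : Polynomial ℝ} {a : ℝ}
    (hq : HasTopCoeff q m a) : L (P m * q) = a * L (P m * P m) := by
  have h0 := hq.sub ((hP.hasTopCoeff m).C_mul a)
  rw [mul_one, sub_self] at h0
  obtain ⟨b, hb⟩ := hP.exists_eq_sum m _ h0.degree_lt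
  have h1 : L (P m * (q - C a * P m)) = 0 := by
    rw [hb, Finset.mul_sum, map_sum]
    refine Finset.sum_eq_zero fun i hi => ?_
    simp [hP.orth m i (Finset.mem_range.1 hi).ne']
  have h2 : P m * (q - C a * P m) = P m * q - a • (P m * P m) := by
    rw [smul_eq_C_mul]; ring
  rw [h2, map_sub, map_smul, smul_eq_mul] at h1
  linarith

lemma norm_succ (hP : IsMonicOPS L P) {m : ℕ} {g1 g2 : ℝ}
    (hrec : X * P (m + 1) = P (m + 2) + C g1 * P (m + 1) + C g2 * P m) :
    L (P (m + 1) * P (m + 1)) = g2 * L (P m * P m) := by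
  have hX : HasTopCoeff (X * P m) (m + 1) 1 := by
    simpa [add_comm] using (HasTopCoeff.linear 1 0).mul (hP.hasTopCoeff m)
  have h1 := hP.map_mul_of_hasTopCoeff hX
  have h2 : P (m + 1) * (X * P m) =
      P (m + 2) * P m + g1 • (P (m + 1) * P m) + g2 • (P m * P m) := by
    simp only [smul_eq_C_mul]
    linear_combination P m * hrec
  rw [h2, map_add, map_add, map_smul, map_smul, hP.orth _ _ (by omega), hP.orth _ _ (by omega)] at h1
  simpa using h1.symm

lemma map_X_mul_sq (hP : IsMonicOPS L P) {m : ℕ} {g1 g2 : ℝ}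
    (hrec : X * P (m + 1) = P (m + 2) + C g1 * P (m + 1) + C g2 * P m) :
    L (X * (P (m + 1) * P (m + 1))) = g1 * L (P (m + 1) * P (m + 1)) := by
  have h2 : X * (P (m + 1) * P (m + 1)) =
      P (m + 2) * P (m + 1) + g1 • (P (m + 1) * P (m + 1)) + g2 • (P m * P (m + 1)) := by
    simp only [smul_eq_C_mul]
    linear_combination P (m + 1) * hrec
  rw [h2, map_add, map_add, map_smul, map_smul, hP.orth (m + 2) _ (by omega), hP.orth m _ (by omega)]
  simp

section Jacobi

variable {α β : ℝ}

lemma map_one_sub_X_sq_mul_derivative_mul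
    (hL : ∀ f, L ((1 - X ^ 2) * derivative f + (C (β - α) - C (α + β + 2) * X) * f) = 0)
    (f g : Polynomial ℝ) : L (g * ((1 - X ^ 2) * derivative f)) =
      -L (f * ((1 - X ^ 2) * derivative g + (C (β - α) - C (α + β + 2) * X) * g)) := by
  rw [eq_neg_iff_add_eq_zero, ← map_add, ← hL (f * g), derivative_mul]
  congr 1
  ring

/-- The structure relation of the monic Jacobi polynomials. -/
lemma structure_relation (hP : IsMonicOPS L P) (hα : -1 < α) (hβ : -1 < β)
    (hL : ∀ f, L ((1 - X ^ 2) * derivative f + (C (β - α) - C (α + β + 2) * X) * f) = 0)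
    {m : ℕ} (hrec : X * P (m + 1) = P (m + 2) + C (gamma1 α β (m + 1)) * P (m + 1) +
      C (gamma2 α β (m + 1)) * P m) :
    (1 - X ^ 2) * derivative (P (m + 1)) = ahat α β (m + 1) * P (m + 1) +
      C ((2 * ((m + 1 : ℕ) : ℝ) + α + β + 1) * gamma2 α β (m + 1)) * P m := by
  set F := (1 - X ^ 2) * derivative (P (m + 1)) with hF
  have hparts := map_one_sub_X_sq_mul_derivative_mul hL (P (m + 1))
  rw [← hF] at hparts
  have hG : ∀ i, HasTopCoeff ((1 - X ^ 2) * derivative (P i) +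
      (C (β - α) - C (α + β + 2) * X) * P i) (i + 1) (-i + -(α + β + 2)) := by
    intro i
    have h1 : HasTopCoeff (C (β - α) - C (α + β + 2) * X) 1 (-(α + β + 2)) := by
      convert HasTopCoeff.linear (-(α + β + 2)) (β - α) using 1
      rw [C_neg]
      ring
    have h2 := (hP.hasTopCoeff i).one_sub_X_sq_mul_derivative.add
      (by simpa only [add_comm 1 i] using h1.mul (hP.hasTopCoeff i))
    simpa using h2
  have hlow : ∀ i < m, L (P i * F) = 0 := by
    intro i hi
    rw [hparts, hP.map_mul_of_hasTopCoeff ((hG i).of_lt (by omega))]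
    simp
  have hmid : L (P m * F) = (m + α + β + 2) * L (P (m + 1) * P (m + 1)) := by
    rw [hparts, hP.map_mul_of_hasTopCoeff (hG m)]
    ring
  have hdiag : L (P (m + 1) * F) = -(1 / 2) * (β - α - (α + β + 2) * gamma1 α β (m + 1)) *
      L (P (m + 1) * P (m + 1)) := by
    have h1 := hparts (P (m + 1))
    rw [← hF] at h1
    have h2 : P (m + 1) * (F + (C (β - α) - C (α + β + 2) * X) * P (m + 1)) =
        P (m + 1) * F + (β - α) • (P (m + 1) * P (m + 1)) -
          (α + β + 2) • (X * (P (m + 1) * P (m + 1))) := by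
      simp only [smul_eq_C_mul]
      ring
    rw [h2, map_sub, map_add, map_smul, map_smul, hP.map_X_mul_sq hrec, smul_eq_mul,
      smul_eq_mul] at h1
    linarith
  have htop := (hP.hasTopCoeff (m + 1)).one_sub_X_sq_mul_derivative.add
    ((hP.hasTopCoeff (m + 2)).C_mul ((m + 1 : ℕ) : ℝ))
  rw [← hF, show -((m + 1 : ℕ) : ℝ) * 1 + ((m + 1 : ℕ) : ℝ) * 1 = 0 by ring] at htop
  have hexp := hP.eq_sum (m + 2) htop.degree_lt
  have hcoef : ∀ i < m + 2, L (P i * (F + C ((m + 1 : ℕ) : ℝ) * P (m + 2))) = L (P i * F) := by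
    intro i hi
    rw [mul_add, map_add, ← smul_eq_C_mul, mul_smul_comm, map_smul, hP.orth _ _ hi.ne, smul_zero,
      add_zero]
  rw [Finset.sum_range_succ, Finset.sum_range_succ, Finset.sum_eq_zero, hcoef _ (by omega),
    hcoef _ (by omega), hmid, hdiag, hP.norm_succ hrec, ← hP.norm_succ hrec,
    mul_div_cancel_right₀ _ (hP.norm_pos _).ne', hP.norm_succ hrec, ← mul_assoc,
    mul_div_cancel_right₀ _ (hP.norm_pos _).ne', zero_add] at hexp
  · have hX : P (m + 2) = X * P (m + 1) - C (gamma1 α β (m + 1)) * P (m + 1) -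
        C (gamma2 α β (m + 1)) * P m := by
      rw [hrec]; ring
    rw [hX] at hexp
    rw [eq_sub_of_add_eq hexp]
    refine Polynomial.funext fun x => ?_
    have h2 : 2 * ((m : ℝ) + 1) + α + β ≠ 0 := by
      have : (0 : ℝ) ≤ m := m.cast_nonneg
      linarith
    have h3 : 2 * ((m : ℝ) + 1) + α + β + 2 ≠ 0 := by
      have : (0 : ℝ) ≤ m := m.cast_nonneg
      linarith
    simp only [ahat, eval_add, eval_sub, eval_mul, eval_C, eval_X, eval_smul, smul_eq_mul]
    push_cast
    generalize gamma2 α β (m + 1) = g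
    rw [gamma1]
    push_cast
    field_simp
    ring
  · intro i hi
    have := Finset.mem_range.1 hi
    rw [hcoef i (by omega), hlow i this, zero_div, zero_smul]

lemma structure_relation_succ (hP : IsMonicOPS L P) (hα : -1 < α) (hβ : -1 < β)
    (hL : ∀ f, L ((1 - X ^ 2) * derivative f + (C (β - α) - C (α + β + 2) * X) * f) = 0)
    {m : ℕ} (hrec : X * P (m + 1) = P (m + 2) + C (gamma1 α β (m + 1)) * P (m + 1) +
      C (gamma2 α β (m + 1)) * P m) :
    (1 - X ^ 2) * derivative (P (m + 1)) =
      chat α β (m + 2) * P (m + 1) + C (dhat α β (m + 2)) * P (m + 2) := by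
  rw [hP.structure_relation hα hβ hL hrec, C_mul, mul_assoc,
    show C (gamma2 α β (m + 1)) * P m =
      X * P (m + 1) - P (m + 2) - C (gamma1 α β (m + 1)) * P (m + 1) by rw [hrec]; ring]
  refine Polynomial.funext fun x => ?_
  have h0 : (0 : ℝ) ≤ m := m.cast_nonneg
  have h2 : 2 * ((m : ℝ) + 1) + α + β ≠ 0 := by linarith
  have h3 : 2 * ((m : ℝ) + 2) + α + β ≠ 0 := by linarith
  have h4 : 2 * ((m : ℝ) + 2) + α + β = 2 * ((m : ℝ) + 1) + α + β + 2 := by ring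
  rw [h4] at h3
  simp only [ahat, chat, dhat, gamma1, eval_add, eval_sub, eval_mul, eval_C, eval_X]
  push_cast
  rw [h4]
  obtain ⟨s, hs⟩ : ∃ s, 2 * ((m : ℝ) + 1) + α + β = s := ⟨_, rfl⟩
  rw [hs] at h2 h3 ⊢
  field_simp
  rw [← hs]
  ring

end Jacobi

end IsMonicOPS

lemma sum_sub_mul_eq_of_recurrence {p t u h g1 g2 : ℕ → ℝ} {g x c : ℝ}
    (hp0 : x * p 0 = p 1 + g * p 0)
    (hp : ∀ m, x * p (m + 1) = p (m + 2) + g1 m * p (m + 1) + g2 m * p m)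
    (ht0 : c * t 0 + u 0 = t 1 + g * t 0)
    (ht : ∀ m, c * t (m + 1) + u (m + 1) = t (m + 2) + g1 m * t (m + 1) + g2 m * t m)
    (hh : ∀ m, h m ≠ 0) (hg : ∀ m, h (m + 1) = g2 m * h m) (n : ℕ) :
    (x - c) * ∑ i ∈ Finset.range (n + 1), t i * p i / h i =
      ∑ i ∈ Finset.range (n + 1), u i * p i / h i +
        (t n * p (n + 1) - t (n + 1) * p n) / h n := by
  induction n with
  | zero =>
    have := hh 0
    simp only [zero_add, Finset.sum_range_one]
    field_simp
    linear_combination t 0 * hp0 - p 0 * ht0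
  | succ n ih =>
    have h1 := hh n
    have h2 := hh (n + 1)
    rw [Finset.sum_range_succ, mul_add, ih, Finset.sum_range_succ _ (n + 1), add_assoc, add_assoc,
      add_right_inj]
    have h3 : (t n * p (n + 1) - t (n + 1) * p n) / h n =
        g2 n * (t n * p (n + 1) - t (n + 1) * p n) / h (n + 1) := by
      rw [hg] at h2 ⊢
      have := left_ne_zero_of_mul h2
      field_simp
    rw [h3]
    field_simp
    linear_combination t (n + 1) * hp n - p (n + 1) * ht n

lemma eval_iterDeriv (k : ℕ) (f : Polynomial ℝ) (c : ℝ) :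
    (iterDeriv k f).eval c = k.factorial * (taylor c f).coeff k := by
  rw [taylor_coeff, iterDeriv, ← factorial_smul_hasseDeriv]
  simp

lemma taylorPoly_eq (k : ℕ) (c : ℝ) (f : Polynomial ℝ) :
    taylorPoly k c f = ∑ ν ∈ Finset.range (k + 1), C ((taylor c f).coeff ν) * (X - C c) ^ ν := by
  refine Finset.sum_congr rfl fun ν _ => ?_
  rw [eval_iterDeriv, mul_div_cancel_left₀ _ (by positivity)]

lemma taylor_X_mul_coeff_zero (c : ℝ) (f : Polynomial ℝ) :
    (taylor c (X * f)).coeff 0 = c * (taylor c f).coeff 0 := by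
  simp [add_mul]

lemma taylor_X_mul_coeff_succ (c : ℝ) (f : Polynomial ℝ) (k : ℕ) :
    (taylor c (X * f)).coeff (k + 1) = c * (taylor c f).coeff (k + 1) + (taylor c f).coeff k := by
  rw [taylor_mul, taylor_X, add_mul, coeff_add, coeff_X_mul, coeff_C_mul, add_comm]

lemma taylor_C_mul_coeff (c a : ℝ) (f : Polynomial ℝ) (k : ℕ) :
    (taylor c (C a * f)).coeff k = a * (taylor c f).coeff k := by
  rw [taylor_mul, taylor_C, coeff_C_mul]

/-- The Christoffel–Darboux formula for the `k`-th derivative of the kernel in one variable. -/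
lemma pow_mul_kernel_eq {P : ℕ → Polynomial ℝ} {h g1 g2 : ℕ → ℝ} {g : ℝ}
    (h0 : X * P 0 = P 1 + C g * P 0)
    (hrec : ∀ m, X * P (m + 1) = P (m + 2) + C (g1 m) * P (m + 1) + C (g2 m) * P m)
    (hh : ∀ m, h m ≠ 0) (hg : ∀ m, h (m + 1) = g2 m * h m) (x c : ℝ) (n k : ℕ) :
    (x - c) ^ (k + 1) * ∑ i ∈ Finset.range (n + 1),
        (taylor c (P i)).coeff k * (P i).eval x / h i =
      ((taylorPoly k c (P n)).eval x * (P (n + 1)).eval x -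
        (taylorPoly k c (P (n + 1))).eval x * (P n).eval x) / h n := by
  have hp0 : x * (P 0).eval x = (P 1).eval x + g * (P 0).eval x := by
    simpa using congrArg (eval x) h0
  have hp : ∀ m, x * (P (m + 1)).eval x =
      (P (m + 2)).eval x + g1 m * (P (m + 1)).eval x + g2 m * (P m).eval x := fun m => by
    simpa using congrArg (eval x) (hrec m)
  induction k with
  | zero =>
    have key := sum_sub_mul_eq_of_recurrence (p := fun i => (P i).eval x)
      (t := fun i => (taylor c (P i)).coeff 0) (u := fun _ => 0) (c := c) hp0 hp
      (by rw [add_zero, ← taylor_X_mul_coeff_zero, h0, map_add, coeff_add, taylor_C_mul_coeff])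
      (fun m => by
        rw [add_zero, ← taylor_X_mul_coeff_zero, hrec, map_add, map_add, coeff_add, coeff_add,
          taylor_C_mul_coeff, taylor_C_mul_coeff]) hh hg n
    simp only [zero_mul, zero_div, Finset.sum_const_zero, zero_add] at key
    simpa [taylorPoly_eq] using key
  | succ k ih =>
    have key := sum_sub_mul_eq_of_recurrence (p := fun i => (P i).eval x)
      (t := fun i => (taylor c (P i)).coeff (k + 1)) (u := fun i => (taylor c (P i)).coeff k)
      (c := c) hp0 hp
      (by rw [← taylor_X_mul_coeff_succ, h0, map_add, coeff_add, taylor_C_mul_coeff])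
      (fun m => by
        rw [← taylor_X_mul_coeff_succ, hrec, map_add, map_add, coeff_add, coeff_add,
          taylor_C_mul_coeff, taylor_C_mul_coeff]) hh hg n
    rw [pow_succ, mul_assoc, key, mul_add, ih]
    simp only [taylorPoly_eq, Finset.sum_range_succ _ (k + 1), eval_add, eval_mul, eval_pow,
      eval_sub, eval_X, eval_C]
    ring

lemma rhoPoly_eq {N : ℕ} (c : Fin N → ℝ) (dd : Fin N → ℕ) {j : Fin N} {k : ℕ}
    (hk : k ∈ Finset.range (dd j + 1)) :
    rhoPoly c dd = (X - C (c j)) ^ (k + 1) * rhoJK c dd j k := by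
  have : dd j + 1 = k + 1 + (dd j - k) := by
    have := Finset.mem_range.1 hk
    omega
  rw [rhoPoly, ← Finset.mul_prod_erase _ _ (Finset.mem_univ j), rhoJK, this, pow_add, mul_assoc]

lemma monic_rhoPoly {N : ℕ} (c : Fin N → ℝ) (dd : Fin N → ℕ) : (rhoPoly c dd).Monic :=
  monic_prod_of_monic _ _ fun _ _ => (monic_X_sub_C _).pow _

lemma natDegree_rhoPoly {N : ℕ} (c : Fin N → ℝ) (dd : Fin N → ℕ) :
    (rhoPoly c dd).natDegree = ∑ j, (dd j + 1) := by
  rw [rhoPoly, natDegree_prod_of_monic _ _ fun _ _ => (monic_X_sub_C _).pow _]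
  simp

lemma hasTopCoeff_rhoJK {N : ℕ} (c : Fin N → ℝ) (dd : Fin N → ℕ) {j : Fin N} {k e : ℕ}
    (hk : k ∈ Finset.range (dd j + 1)) (he : ∑ j, (dd j + 1) = e + 1) :
    k ≤ e ∧ HasTopCoeff (rhoJK c dd j k) (e - k) 1 := by
  have hm : (rhoJK c dd j k).Monic := ((monic_X_sub_C _).pow _).mul
    (monic_prod_of_monic _ _ fun _ _ => (monic_X_sub_C _).pow _)
  have h1 := natDegree_rhoPoly c dd
  rw [he, rhoPoly_eq c dd hk, ((monic_X_sub_C _).pow _).natDegree_mul hm, natDegree_pow,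
    natDegree_X_sub_C] at h1
  refine ⟨by omega, ?_⟩
  convert HasTopCoeff.of_monic hm using 1
  omega

lemma hasTopCoeff_taylorPoly (k : ℕ) (c : ℝ) (f : Polynomial ℝ) :
    HasTopCoeff (taylorPoly k c f) k ((taylor c f).coeff k) := by
  have hpow : ∀ ν, HasTopCoeff ((X - C c) ^ ν) ν 1 := fun ν => by
    simpa using HasTopCoeff.of_monic ((monic_X_sub_C c).pow ν)
  rw [taylorPoly_eq, Finset.sum_range_succ]
  have h1 : HasTopCoeff (∑ ν ∈ Finset.range k, C ((taylor c f).coeff ν) * (X - C c) ^ ν) k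
      (∑ ν ∈ Finset.range k, 0) := HasTopCoeff.sum _ fun ν hν =>
    ((hpow ν).C_mul _).of_lt (Finset.mem_range.1 hν)
  simpa using h1.add ((hpow k).C_mul _)

/-- The sums appearing in the coefficients of the connection formula. -/
lemma hasTopCoeff_connection_sum {N : ℕ} (c : Fin N → ℝ) (dd : Fin N → ℕ)
    (lam : Fin N → ℕ → ℝ) {e : ℕ} (he : ∑ j, (dd j + 1) = e + 1) (s f : Polynomial ℝ) (h : ℝ) :
    HasTopCoeff (∑ j : Fin N, ∑ k ∈ Finset.range (dd j + 1),
        C ((Nat.factorial k : ℝ) * lam j k * (iterDeriv k s).eval (c j) / h) *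
          (taylorPoly k (c j) f * rhoJK c dd j k)) e
      ((∑ j : Fin N, ∑ k ∈ Finset.range (dd j + 1),
        lam j k * (iterDeriv k f).eval (c j) * (iterDeriv k s).eval (c j)) / h) := by
  simp only [Finset.sum_div]
  refine HasTopCoeff.sum _ fun j _ => HasTopCoeff.sum _ fun k hk => ?_
  obtain ⟨hke, hr⟩ := hasTopCoeff_rhoJK c dd hk he
  convert ((hasTopCoeff_taylorPoly k (c j) f).mul hr).C_mul _ using 1
  · omega
  · rw [eval_iterDeriv k f]
    ring

/-- The connection formula expressing a Sobolev orthogonal polynomial through two consecutive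
orthogonal polynomials. -/
lemma IsMonicOPS.connection {L : Polynomial ℝ →ₗ[ℝ] ℝ} {P : ℕ → Polynomial ℝ}
    (hP : IsMonicOPS L P) {g1 g2 : ℕ → ℝ}
    (hrec : ∀ m, X * P (m + 1) = P (m + 2) + C (g1 m) * P (m + 1) + C (g2 m) * P m)
    {N : ℕ} (c : Fin N → ℝ) (dd : Fin N → ℕ) (lam : Fin N → ℕ → ℝ) (m : ℕ)
    {s : Polynomial ℝ} (hs : HasTopCoeff s (m + 1) 1)
    (horth : ∀ i < m + 1, L (P i * s) + ∑ j : Fin N, ∑ k ∈ Finset.range (dd j + 1),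
      lam j k * (iterDeriv k (P i)).eval (c j) * (iterDeriv k s).eval (c j) = 0) :
    rhoPoly c dd * s =
      (rhoPoly c dd - ∑ j : Fin N, ∑ k ∈ Finset.range (dd j + 1),
        C ((Nat.factorial k : ℝ) * lam j k * (iterDeriv k s).eval (c j) / L (P m * P m)) *
          (taylorPoly k (c j) (P m) * rhoJK c dd j k)) * P (m + 1) +
      (∑ j : Fin N, ∑ k ∈ Finset.range (dd j + 1),
        C ((Nat.factorial k : ℝ) * lam j k * (iterDeriv k s).eval (c j) / L (P m * P m)) *
          (taylorPoly k (c j) (P (m + 1)) * rhoJK c dd j k)) * P m := by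
  have h0 : X * P 0 = P 1 + C (-(P 1).coeff 0) * P 0 := by
    have e0 : P 0 = 1 := by
      simpa [hP.natDegree_eq] using eq_one_of_monic_natDegree_zero (hP.monic 0) (hP.natDegree_eq 0)
    have e1 : P 1 = X + C ((P 1).coeff 0) := (hP.monic 1).eq_X_add_C (hP.natDegree_eq 1)
    rw [e0, C_neg]
    linear_combination -e1
  have hdiff := hs.sub (hP.hasTopCoeff (m + 1))
  rw [sub_self] at hdiff
  have hexp := hP.eq_sum (m + 1) hdiff.degree_lt
  refine Polynomial.funext fun x => ?_
  have hx := congrArg (eval x) hexp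
  rw [eval_finsetSum] at hx
  have hterm : ∀ i ∈ Finset.range (m + 1),
      eval x ((L (P i * (s - P (m + 1))) / L (P i * P i)) • P i) =
        -∑ j : Fin N, ∑ k ∈ Finset.range (dd j + 1),
          (Nat.factorial k * lam j k * (iterDeriv k s).eval (c j)) *
            ((taylor (c j) (P i)).coeff k * (P i).eval x / L (P i * P i)) := by
    intro i hi
    have hi' := Finset.mem_range.1 hi
    rw [mul_sub, map_sub, hP.orth i _ hi'.ne, sub_zero, eq_neg_of_add_eq_zero_left (horth i hi'),
      eval_smul, smul_eq_mul, neg_div, neg_mul, Finset.sum_div, Finset.sum_mul]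
    refine congrArg _ (Finset.sum_congr rfl fun j _ => ?_)
    rw [Finset.sum_div, Finset.sum_mul]
    refine Finset.sum_congr rfl fun k _ => ?_
    rw [eval_iterDeriv k (P i)]
    ring
  rw [Finset.sum_congr rfl hterm, Finset.sum_neg_distrib, Finset.sum_comm, eval_sub,
    sub_eq_iff_eq_add] at hx
  have hK : ∀ j : Fin N, ∀ k ∈ Finset.range (dd j + 1),
      (rhoPoly c dd).eval x * ∑ i ∈ Finset.range (m + 1),
        ((Nat.factorial k : ℝ) * lam j k * (iterDeriv k s).eval (c j)) *
          ((taylor (c j) (P i)).coeff k * (P i).eval x / L (P i * P i)) =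
      ((Nat.factorial k : ℝ) * lam j k * (iterDeriv k s).eval (c j) / L (P m * P m)) *
        ((taylorPoly k (c j) (P m)).eval x * (rhoJK c dd j k).eval x) * (P (m + 1)).eval x -
      ((Nat.factorial k : ℝ) * lam j k * (iterDeriv k s).eval (c j) / L (P m * P m)) *
        ((taylorPoly k (c j) (P (m + 1))).eval x * (rhoJK c dd j k).eval x) * (P m).eval x := by
    intro j k hk
    have key := pow_mul_kernel_eq (h := fun i => L (P i * P i)) h0 hrec
      (fun i => (hP.norm_pos i).ne') (fun i => hP.norm_succ (hrec i)) x (c j) m k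
    rw [← Finset.mul_sum, rhoPoly_eq c dd hk, eval_mul, eval_pow, eval_sub, eval_X, eval_C]
    linear_combination ((Nat.factorial k : ℝ) * lam j k * (iterDeriv k s).eval (c j)) *
      (rhoJK c dd j k).eval x * key
  have hcomm : ∀ (r : ℝ) (T : Fin N → ℕ → ℕ → ℝ),
      r * ∑ j : Fin N, ∑ i ∈ Finset.range (m + 1), ∑ k ∈ Finset.range (dd j + 1), T j i k =
        ∑ j : Fin N, ∑ k ∈ Finset.range (dd j + 1), r * ∑ i ∈ Finset.range (m + 1), T j i k := by
    intro r T
    rw [Finset.mul_sum]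
    refine Finset.sum_congr rfl fun j _ => ?_
    rw [Finset.sum_comm, Finset.mul_sum]
  have hsum := Finset.sum_congr rfl fun j (_ : j ∈ (Finset.univ : Finset (Fin N))) =>
    Finset.sum_congr rfl (hK j)
  simp only [Finset.sum_sub_distrib, ← Finset.sum_mul] at hsum
  simp only [eval_add, eval_sub, eval_mul, eval_finsetSum, eval_C]
  rw [hx, mul_add, mul_neg, hcomm, hsum]
  ring

lemma sobolevIP_eq {α β : ℝ} (hα : -1 < α) (hβ : -1 < β) {N : ℕ} (c : Fin N → ℝ)
    (dd : Fin N → ℕ) (lam : Fin N → ℕ → ℝ) (f g : Polynomial ℝ) :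
    sobolevIP α β c dd lam f g = jacobiFunctional hα hβ (f * g) +
      ∑ j : Fin N, ∑ k ∈ Finset.range (dd j + 1),
        lam j k * (iterDeriv k f).eval (c j) * (iterDeriv k g).eval (c j) := by
  simp [sobolevIP, jacobiFunctional]

/-- The Jacobi–Sobolev inner product with a fixed polynomial, as a linear functional. -/
def sobolevFunctional {α β : ℝ} (hα : -1 < α) (hβ : -1 < β) {N : ℕ} (c : Fin N → ℝ)
    (dd : Fin N → ℕ) (lam : Fin N → ℕ → ℝ) (s : Polynomial ℝ) : Polynomial ℝ →ₗ[ℝ] ℝ where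
  toFun f := sobolevIP α β c dd lam f s
  map_add' f g := by
    simp only [sobolevIP_eq hα hβ, iterDeriv, iterate_map_add, eval_add, add_mul, mul_add,
      map_add, Finset.sum_add_distrib]
    ring
  map_smul' a f := by
    simp only [sobolevIP_eq hα hβ, iterDeriv, iterate_derivative_smul, eval_smul, smul_mul_assoc,
      map_smul, smul_eq_mul, RingHom.id_apply, mul_add, Finset.mul_sum]
    congr 1
    refine Finset.sum_congr rfl fun j _ => Finset.sum_congr rfl fun k _ => ?_
    ring

lemma sobolevIP_eq_zero_of_degree_lt {α β : ℝ} (hα : -1 < α) (hβ : -1 < β) {N : ℕ}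
    {c : Fin N → ℝ} {dd : Fin N → ℕ} {lam : Fin N → ℕ → ℝ} {s : Polynomial ℝ} {m : ℕ}
    (hs : ∀ l < m, sobolevIP α β c dd lam (X ^ l) s = 0) {q : Polynomial ℝ} (hq : q.degree < m) :
    sobolevIP α β c dd lam q s = 0 := by
  change sobolevFunctional hα hβ c dd lam s q = 0
  have hX : ∀ l < m, sobolevFunctional hα hβ c dd lam s (X ^ l) = 0 := hs
  by_cases h0 : q = 0
  · rw [h0, map_zero]
  rw [q.as_sum_range' m ((natDegree_lt_iff_degree_lt h0).2 hq), map_sum]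
  refine Finset.sum_eq_zero fun i hi => ?_
  rw [← C_mul_X_pow_eq_monomial, ← smul_eq_C_mul, map_smul, hX i (Finset.mem_range.1 hi), smul_zero]

/-- The Sobolev norm of the `m`-th Sobolev orthogonal polynomial, computed against `P`. -/
lemma sobolevIP_monic_pos {α β : ℝ} (hα : -1 < α) (hβ : -1 < β) {N : ℕ}
    {c : Fin N → ℝ} {dd : Fin N → ℕ} {lam : Fin N → ℕ → ℝ} (hlam : ∀ j k, 0 ≤ lam j k)
    {s p : Polynomial ℝ} {m : ℕ} (hs : ∀ l < m, sobolevIP α β c dd lam (X ^ l) s = 0)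
    (hsm : HasTopCoeff s m 1) (hp : HasTopCoeff p m 1) : 0 < sobolevIP α β c dd lam p s := by
  have hdiff := hp.sub hsm
  rw [sub_self] at hdiff
  have h1 : sobolevFunctional hα hβ c dd lam s (p - s) = 0 :=
    sobolevIP_eq_zero_of_degree_lt hα hβ hs hdiff.degree_lt
  rw [map_sub, sub_eq_zero] at h1
  change 0 < sobolevFunctional hα hβ c dd lam s p
  rw [h1]
  change 0 < sobolevIP α β c dd lam s s
  rw [sobolevIP_eq hα hβ]
  refine add_pos_of_pos_of_nonneg (jacobiFunctional_sq_pos hα hβ ?_) ?_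
  · rintro rfl
    exact zero_ne_one hsm.2
  · refine Finset.sum_nonneg fun j _ => Finset.sum_nonneg fun k _ => ?_
    rw [mul_assoc]
    exact mul_nonneg (hlam j k) (mul_self_nonneg _)

/-- Elimination step: two connection formulas and the derivative of the first one give the
lowering ladder identity. -/
lemma ladder_identity {ρ δ w p p' s s' a b a3 b3 c2 d2 : Polynomial ℝ} (hρ : ρ ≠ 0)
    (hδ : a * d2 - b * c2 = ρ * δ) (hs : ρ * s = a * p + b * p') (hs' : ρ * s' = c2 * p + d2 * p')
    (hder : w * derivative (ρ * s) = a3 * p + b3 * p') :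
    (w * derivative ρ * δ + b3 * c2 - a3 * d2) * s + w * (a * d2 - b * c2) * derivative s =
      (b3 * a - a3 * b) * s' := by
  have hp : δ * p = d2 * s - b * s' := mul_left_cancel₀ hρ (by
    linear_combination d2 * -hs + b * hs' - p * hδ)
  have hp' : δ * p' = a * s' - c2 * s := mul_left_cancel₀ hρ (by
    linear_combination c2 * hs - a * hs' - p' * hδ)
  rw [derivative_mul] at hder
  rw [hδ]
  linear_combination δ * hder + a3 * hp + b3 * hp'

lemma ladder_natDegree {ρ δ a b ah ch a' b' : Polynomial ℝ} {e : ℕ} {ν σ bh dh y y' γ γ1 : ℝ}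
    (hρ : ρ.Monic) (hρe : ρ.natDegree = e + 1)
    (ha : HasTopCoeff a (e + 1) 1) (hb : HasTopCoeff b e y) (hah : HasTopCoeff ah 1 (-ν))
    (hch : HasTopCoeff ch 1 σ) (ha' : HasTopCoeff a' (e + 1) 1) (hb' : HasTopCoeff b' e y')
    (hν : ν ≠ 0) (hκ : 1 + y' / γ ≠ 0) (hy : bh + (ν + σ + 1) * y ≠ 0)
    {a3 b3 c2 d2 : Polynomial ℝ}
    (ha3 : a3 = (1 - X ^ 2) * derivative a + ah * a + C dh * b)
    (hb3 : b3 = (1 - X ^ 2) * derivative b + C bh * a + ch * b)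
    (hc2 : c2 = C (-(1 / γ)) * b') (hd2 : d2 = a' + C (1 / γ) * b' * (X - C γ1))
    (hδ : a * d2 - b * c2 = ρ * δ) :
    ((1 - X ^ 2) * (a * d2 - b * c2)).natDegree = 2 * (e + 1) + 2 ∧
      (b3 * a - a3 * b).natDegree = 2 * (e + 1) ∧
      ((1 - X ^ 2) * derivative ρ * δ + b3 * c2 - a3 * d2).natDegree = 2 * (e + 1) + 1 := by
  have Hc2 : HasTopCoeff c2 e (-(1 / γ) * y') := hc2 ▸ hb'.C_mul _
  have HX : HasTopCoeff (X - C γ1) 1 1 := by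
    simpa [sub_eq_add_neg] using HasTopCoeff.linear 1 (-γ1)
  have Hd2 : HasTopCoeff d2 (e + 1) (1 + y' / γ) := by
    rw [hd2]
    convert ha'.add ((hb'.C_mul (1 / γ)).mul HX) using 1
    ring
  have HΔ : HasTopCoeff (a * d2 - b * c2) (2 * (e + 1)) (1 + y' / γ) := by
    have h1 := ha.mul Hd2
    rw [← two_mul, one_mul] at h1
    simpa using h1.sub ((hb.mul Hc2).of_lt (by omega : e + e < 2 * (e + 1)))
  have Ha3 : HasTopCoeff a3 (e + 2) (-(e + 1) - ν) := by
    rw [ha3]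
    have h1 := ha.one_sub_X_sq_mul_derivative
    have h2 := hah.mul ha
    rw [show 1 + (e + 1) = e + 1 + 1 by ring] at h2
    convert (h1.add h2).add ((hb.C_mul dh).of_lt (by omega : e < e + 1 + 1)) using 1
    push_cast
    ring
  have Hb3 : HasTopCoeff b3 (e + 1) (-e * y + bh + σ * y) := by
    rw [hb3]
    have h2 := hch.mul hb
    rw [add_comm 1 e] at h2
    simpa using (hb.one_sub_X_sq_mul_derivative.add (ha.C_mul bh)).add h2
  have Hρ : HasTopCoeff ρ (e + 1) 1 := hρe ▸ HasTopCoeff.of_monic hρ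
  have hΔ0 : ρ * δ ≠ 0 := by
    rw [← hδ]
    intro h0
    rw [h0] at HΔ
    exact hκ (by simpa using HΔ.2.symm)
  have Hδ : HasTopCoeff δ (e + 1) (1 + y' / γ) := by
    have h1 := HΔ.natDegree_eq hκ
    have h2 := HΔ.2
    rw [← h1, hδ, coeff_natDegree, leadingCoeff_mul, hρ.leadingCoeff, one_mul] at h2
    rw [hδ, hρ.natDegree_mul' (right_ne_zero_of_mul hΔ0), hρe] at h1
    have h3 : δ.natDegree = e + 1 := by omega
    exact ⟨h3.le, by rw [← h2, leadingCoeff, h3]⟩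
  refine ⟨?_, ?_, ?_⟩
  · refine ((add_comm 2 _ ▸ HasTopCoeff.one_sub_X_sq.mul HΔ :)).natDegree_eq ?_
    exact mul_ne_zero (neg_ne_zero.2 one_ne_zero) hκ
  · have h1 := Hb3.mul ha
    have h2 := Ha3.mul hb
    rw [show e + 2 + e = e + 1 + (e + 1) by ring] at h2
    rw [two_mul]
    refine (h1.sub h2).natDegree_eq ?_
    convert hy using 1
    ring
  · have h1 := Hρ.one_sub_X_sq_mul_derivative.mul Hδ
    have h2 := (Hb3.mul Hc2).of_lt (by omega : e + 1 + e < e + 1 + 1 + (e + 1))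
    have h3 := Ha3.mul Hd2
    rw [show e + 2 + (e + 1) = e + 1 + 1 + (e + 1) by ring] at h3
    rw [show 2 * (e + 1) + 1 = e + 1 + 1 + (e + 1) by ring]
    refine ((h1.add h2).sub h3).natDegree_eq ?_
    convert mul_ne_zero hν hκ using 1
    push_cast
    ring

theorem stmt12 (α β : ℝ) (hα : -1 < α) (hβ : -1 < β)
    (N : ℕ) (hN : 1 ≤ N)
    (c : Fin N → ℝ) (hc : Function.Injective c) (hcout : ∀ j, c j ∉ Set.Ioo (-1 : ℝ) 1)
    (dd : Fin N → ℕ) (hdd : Monotone dd)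
    (lam : Fin N → ℕ → ℝ) (hlam : ∀ j k, 0 ≤ lam j k) (hlamd : ∀ j, 0 < lam j (dd j))
    (d : ℕ) (hd : d = ∑ j, (dd j + 1))
    (P : ℕ → Polynomial ℝ) (hPm : ∀ m, (P m).Monic) (hPd : ∀ m, (P m).natDegree = m)
    (hPo : ∀ m l, m ≠ l → ∫ x, (P m).eval x * (P l).eval x ∂(jacobiMeasure α β) = 0)
    (h : ℕ → ℝ) (hh : ∀ m, h m = ∫ x, ((P m).eval x) ^ 2 ∂(jacobiMeasure α β))
    (S : ℕ → Polynomial ℝ) (hSm : ∀ m, (S m).Monic) (hSd : ∀ m, (S m).natDegree = m)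
    (hSo : ∀ m l, l < m → sobolevIP α β c dd lam (X ^ l) (S m) = 0)
    (A2 B2 : ℕ → Polynomial ℝ)
    (hA2 : ∀ m, 1 ≤ m → A2 m = rhoPoly c dd -
      ∑ j : Fin N, ∑ k ∈ Finset.range (dd j + 1),
        Polynomial.C ((Nat.factorial k : ℝ) * lam j k * (iterDeriv k (S m)).eval (c j) / h (m - 1)) *
          (taylorPoly k (c j) (P (m - 1)) * rhoJK c dd j k))
    (hB2 : ∀ m, 1 ≤ m → B2 m =
      ∑ j : Fin N, ∑ k ∈ Finset.range (dd j + 1),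
        Polynomial.C ((Nat.factorial k : ℝ) * lam j k * (iterDeriv k (S m)).eval (c j) / h (m - 1)) *
          (taylorPoly k (c j) (P m) * rhoJK c dd j k))
    (A3 B3 : ℕ → Polynomial ℝ)
    (hA3 : ∀ m, 1 ≤ m → A3 m = (1 - X ^ 2) * Polynomial.derivative (A2 m) +
      ahat α β m * A2 m + Polynomial.C (dhat α β m) * B2 m)
    (hB3 : ∀ m, 1 ≤ m → B3 m = (1 - X ^ 2) * Polynomial.derivative (B2 m) +
      Polynomial.C (bhat α β m) * A2 m + chat α β m * B2 m)
    (hrec : ∀ m, 1 ≤ m → X * P m =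
      P (m + 1) + Polynomial.C (gamma1 α β m) * P m + Polynomial.C (gamma2 α β m) * P (m - 1))
    (C2 D2 : ℕ → Polynomial ℝ)
    (hC2 : ∀ m, 2 ≤ m → C2 m = Polynomial.C (-(1 / gamma2 α β (m - 1))) * B2 (m - 1))
    (hD2 : ∀ m, 2 ≤ m → D2 m = A2 (m - 1) +
      Polynomial.C (1 / gamma2 α β (m - 1)) * B2 (m - 1) * (X - Polynomial.C (gamma1 α β (m - 1))))
    (δ : ℕ → Polynomial ℝ)
    (hδ : ∀ m, 2 ≤ m → A2 m * D2 m - B2 m * C2 m = rhoPoly c dd * δ m)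
    (q0 : ℕ → Polynomial ℝ)
    (hq0 : ∀ m, 2 ≤ m → q0 m = (1 - X ^ 2) * (A2 m * D2 m - B2 m * C2 m))
    (q1 q2 : ℕ → Polynomial ℝ)
    (hq1 : ∀ m, 1 ≤ m → q1 m = B3 m * A2 m - A3 m * B2 m)
    (hq2 : ∀ m, 2 ≤ m → q2 m = (1 - X ^ 2) * Polynomial.derivative (rhoPoly c dd) * δ m +
      B3 m * C2 m - A3 m * D2 m)
    (n : ℕ) (hn : 2 ≤ n) :
    q2 n * S n + q0 n * Polynomial.derivative (S n) = q1 n * S (n - 1) ∧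
      (d + 1 ≤ n → (q0 n).natDegree = 2 * d + 2 ∧ (q1 n).natDegree = 2 * d ∧
        (q2 n).natDegree = 2 * d + 1) := by
  obtain ⟨m, rfl⟩ : ∃ m, n = m + 2 := ⟨n - 2, by omega⟩
  have hP : IsMonicOPS (jacobiFunctional hα hβ) P :=
    { pos := fun _ hp => jacobiFunctional_sq_pos hα hβ hp
      monic := hPm
      natDegree_eq := hPd
      orth := fun i l hil => by simpa [jacobiFunctional] using hPo i l hil }
  have hh' : ∀ i, h i = jacobiFunctional hα hβ (P i * P i) := fun i => by
    rw [hh]; simp [jacobiFunctional, sq]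
  have hrec' : ∀ i, X * P (i + 1) = P (i + 2) + C (gamma1 α β (i + 1)) * P (i + 1) +
      C (gamma2 α β (i + 1)) * P i := fun i => hrec (i + 1) (by omega)
  have hStop : ∀ i, HasTopCoeff (S i) i 1 := fun i => by
    simpa only [hSd] using HasTopCoeff.of_monic (hSm i)
  have hconn : ∀ i, rhoPoly c dd * S (i + 1) = A2 (i + 1) * P (i + 1) + B2 (i + 1) * P i := by
    intro i
    rw [hA2 (i + 1) (by omega), hB2 (i + 1) (by omega), Nat.add_sub_cancel, hh']
    refine hP.connection hrec' c dd lam i (hStop _) fun l hl => ?_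
    rw [← sobolevIP_eq hα hβ]
    refine sobolevIP_eq_zero_of_degree_lt hα hβ (hSo (i + 1)) ?_
    rw [degree_eq_natDegree (hPm l).ne_zero, hPd]
    exact_mod_cast hl
  have hnorm : ∀ i, h (i + 1) = gamma2 α β (i + 1) * h i := fun i => by
    rw [hh', hh', hP.norm_succ (hrec' i)]
  have hpos : ∀ i, 0 < h i := fun i => hh' i ▸ hP.norm_pos i
  have hγ : ∀ i, 0 < gamma2 α β (i + 1) := fun i =>
    pos_of_mul_pos_left (hnorm i ▸ hpos (i + 1)) (hpos i).le
  have hn2 : m + 2 - 1 = m + 1 := rfl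
  have hC := hC2 (m + 2) hn
  have hD := hD2 (m + 2) hn
  have hA := hA3 (m + 2) (by omega)
  have hB := hB3 (m + 2) (by omega)
  have hΔ := hδ (m + 2) hn
  rw [hq0 _ hn, hq1 (m + 2) (by omega), hq2 _ hn]
  rw [hn2] at hC hD ⊢
  constructor
  · refine ladder_identity (monic_rhoPoly c dd).ne_zero hΔ (hconn (m + 1)) ?_ ?_
    · have hγP : P m = C (1 / gamma2 α β (m + 1)) *
          ((X - C (gamma1 α β (m + 1))) * P (m + 1) - P (m + 2)) := by
        rw [show (X - C (gamma1 α β (m + 1))) * P (m + 1) - P (m + 2) =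
          C (gamma2 α β (m + 1)) * P m by linear_combination hrec' m, ← mul_assoc, ← C_mul,
          one_div_mul_cancel (hγ m).ne', C_1, one_mul]
      rw [hconn m, hC, hD, C_neg]
      linear_combination B2 (m + 1) * hγP
    · have hs1 := hP.structure_relation hα hβ (jacobiFunctional_pearson hα hβ) (hrec' (m + 1))
      have hs2 := hP.structure_relation_succ hα hβ (jacobiFunctional_pearson hα hβ) (hrec' m)
      rw [← bhat_eq hα hβ (by omega)] at hs1
      rw [hconn (m + 1), hA, hB, derivative_add, derivative_mul, derivative_mul]
      linear_combination A2 (m + 2) * hs1 + B2 (m + 2) * hs2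
  · intro _
    obtain ⟨e, rfl⟩ : ∃ e, d = e + 1 := by
      refine ⟨d - 1, (Nat.sub_add_cancel ?_).symm⟩
      rw [hd]
      exact (Nat.succ_pos _).trans_le (Finset.single_le_sum (f := fun j => dd j + 1)
        (fun _ _ => Nat.zero_le _) (Finset.mem_univ (⟨0, hN⟩ : Fin N)))
    have hBtop : ∀ i, ∃ y, HasTopCoeff (B2 (i + 1)) e y ∧ 0 < gamma2 α β (i + 1) + y := by
      intro i
      have hsum := hasTopCoeff_connection_sum c dd lam hd.symm (S (i + 1)) (P (i + 1)) (h i)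
      refine ⟨_, hB2 (i + 1) (by omega) ▸ hsum, ?_⟩
      have hIP := sobolevIP_monic_pos hα hβ hlam (hSo (i + 1)) (hStop (i + 1))
        (hP.hasTopCoeff (i + 1))
      rw [sobolevIP_eq hα hβ, hP.map_mul_of_hasTopCoeff (hStop (i + 1)), one_mul, ← hh',
        hnorm] at hIP
      have := hpos i
      rw [← mul_div_cancel_right₀ (gamma2 α β (i + 1)) this.ne', ← add_div]
      exact div_pos hIP this
    have hAtop : ∀ i, HasTopCoeff (A2 (i + 1)) (e + 1) 1 := by
      intro i
      rw [hA2 (i + 1) (by omega)]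
      have hρ := HasTopCoeff.of_monic (monic_rhoPoly c dd)
      rw [natDegree_rhoPoly, ← hd] at hρ
      simpa using hρ.sub ((hasTopCoeff_connection_sum c dd lam hd.symm (S (i + 1)) (P i)
        (h i)).of_lt (Nat.lt_succ_self e))
    obtain ⟨y, hy, hypos⟩ := hBtop (m + 1)
    obtain ⟨y', hy', hypos'⟩ := hBtop m
    have hm0 : (0 : ℝ) ≤ m := m.cast_nonneg
    have hs0 : 2 * ((m + 2 : ℕ) : ℝ) + α + β ≠ 0 := by
      push_cast
      linarith
    have hah : HasTopCoeff (ahat α β (m + 2)) 1 (-((m + 2 : ℕ) : ℝ)) := by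
      convert (HasTopCoeff.linear (2 * ((m + 2 : ℕ) : ℝ) + α + β) (β - α)).C_mul
        (-((m + 2 : ℕ) : ℝ) / (2 * ((m + 2 : ℕ) : ℝ) + α + β)) using 1
      · rfl
      · exact (div_mul_cancel₀ _ hs0).symm
    have hch : HasTopCoeff (chat α β (m + 2)) 1 (((m + 2 : ℕ) : ℝ) + α + β) := by
      convert (HasTopCoeff.linear (2 * ((m + 2 : ℕ) : ℝ) + α + β) (α - β)).C_mul
        ((((m + 2 : ℕ) : ℝ) + α + β) / (2 * ((m + 2 : ℕ) : ℝ) + α + β)) using 1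
      · rfl
      · exact (div_mul_cancel₀ _ hs0).symm
    refine ladder_natDegree (monic_rhoPoly c dd) ((natDegree_rhoPoly c dd).trans hd.symm)
      (hAtop (m + 1)) hy hah hch (hAtop m) hy' (by positivity) ?_ ?_ hA hB hC hD hΔ
    · have := hγ m
      rw [← div_self this.ne', ← add_div]
      exact (div_pos hypos' this).ne'
    · rw [bhat_eq hα hβ (by omega)]
      have h1 : 0 < 2 * ((m + 2 : ℕ) : ℝ) + α + β + 1 := by
        push_cast
        linarith
      have h2 := mul_pos h1 hypos
      refine (h2.trans_eq ?_).ne'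
      ring
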